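/- arXiv:2205.04955 — 2 statements merged into one kernel-verified Lean document; each statement's English description precedes it below -/
import Mathlib

section
/- For every real c > 0, every n ≥ 1, all vectors y, ỹ ∈ ℝⁿ, and every index j ∈ {1, …, n}, the componentwise inequality |ỹ_j/√(c² + ‖ỹ‖²) − y_j/√(c² + ‖y‖²)| ≤ ((n+1)/c)·‖ỹ − y‖ holds, where ‖·‖ denotes the Euclidean norm on ℝⁿ. -/
/-- For c > 0, n ≥ 1, y, ytil ∈ ℝⁿ (ytil playing the role of ỹ) and each index j,
|ỹ_j/√(c² + ‖ỹ‖²) − y_j/√(c² + ‖y‖²)| ≤ ((n+1)/c)‖ỹ − y‖. -/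
theorem stmt_2 (c : ℝ) (hc : 0 < c) (n : ℕ) (hn : 1 ≤ n)
    (y ytil : EuclideanSpace ℝ (Fin n)) (j : Fin n) :
    |ytil j / Real.sqrt (c ^ 2 + ‖ytil‖ ^ 2) - y j / Real.sqrt (c ^ 2 + ‖y‖ ^ 2)| ≤
      (((n : ℝ) + 1) / c) * ‖ytil - y‖ := by
  have hu : |ytil j - y j| ≤ ‖ytil - y‖ := by
    have h := PiLp.norm_apply_le (ytil - y) j
    simpa [Real.norm_eq_abs] using h
  have hv : |y j| ≤ ‖y‖ := by
    have h := PiLp.norm_apply_le y j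
    simpa [Real.norm_eq_abs] using h
  have hab : |‖y‖ - ‖ytil‖| ≤ ‖ytil - y‖ := by
    rw [norm_sub_rev]
    exact abs_norm_sub_norm_le y ytil
  have ha := norm_nonneg ytil
  have hb := norm_nonneg y
  have hd := norm_nonneg (ytil - y)
  generalize ‖ytil - y‖ = d at *
  generalize ‖ytil‖ = a at *
  generalize ‖y‖ = b at *
  generalize ytil j = u at *
  generalize y j = v at *
  have hA2 : Real.sqrt (c ^ 2 + a ^ 2) ^ 2 = c ^ 2 + a ^ 2 := Real.sq_sqrt (by positivity)
  have hB2 : Real.sqrt (c ^ 2 + b ^ 2) ^ 2 = c ^ 2 + b ^ 2 := Real.sq_sqrt (by positivity)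
  have hAc : c ≤ Real.sqrt (c ^ 2 + a ^ 2) := Real.le_sqrt_of_sq_le (by nlinarith)
  have hAa : a ≤ Real.sqrt (c ^ 2 + a ^ 2) := Real.le_sqrt_of_sq_le (by nlinarith)
  have hBc : c ≤ Real.sqrt (c ^ 2 + b ^ 2) := Real.le_sqrt_of_sq_le (by nlinarith)
  have hBb : b ≤ Real.sqrt (c ^ 2 + b ^ 2) := Real.le_sqrt_of_sq_le (by nlinarith)
  generalize Real.sqrt (c ^ 2 + a ^ 2) = A at *
  generalize Real.sqrt (c ^ 2 + b ^ 2) = B at *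
  have hA : 0 < A := by linarith
  have hB : 0 < B := by linarith
  have hBA : |B - A| ≤ d := by
    have h1 : |B - A| * (B + A) = |b - a| * (b + a) := by
      rw [← abs_of_pos (show 0 < B + A by linarith), ← abs_mul,
        ← abs_of_nonneg (show 0 ≤ b + a by linarith), ← abs_mul]
      congr 1
      nlinarith
    have h2 : |b - a| * (b + a) ≤ d * (B + A) :=
      mul_le_mul hab (by linarith) (by linarith) hd
    exact le_of_mul_le_mul_right (h1.le.trans h2) (by linarith)
  have key : u / A - v / B = ((u - v) + v / B * (B - A)) / A := by
    field_simp
    ring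
  have hvB : |v / B| ≤ 1 := by
    rw [abs_div, abs_of_pos hB, div_le_one hB]
    linarith
  have hnum : |(u - v) + v / B * (B - A)| ≤ 2 * d := by
    refine (abs_add_le _ _).trans ?_
    rw [abs_mul]
    have := mul_le_mul hvB hBA (abs_nonneg _) zero_le_one
    linarith
  have hn' : (1 : ℝ) ≤ n := by exact_mod_cast hn
  rw [key, abs_div, abs_of_pos hA]
  calc |(u - v) + v / B * (B - A)| / A ≤ (2 * d) / c :=
        div_le_div₀ (by linarith) hnum hc hAc
    _ ≤ (((n : ℝ) + 1) * d) / c := by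
        gcongr
        linarith
    _ = (((n : ℝ) + 1) / c) * d := by ring
end

section
/- Let c > 0, let Ω ⊆ ℝ³ be a measurable set equipped with Lebesgue measure, let y : ℝ³ → ℝ³ be measurable, let u : ℝ³ → ℝ³ be differentiable with the function x ↦ (∑_{i,j} (∂_j u_i(x))²)^{1/2} square-integrable on Ω, and let v : ℝ³ → ℝ³ be measurable and square-integrable on Ω. Then the function x ↦ ∑_{i=1}^3 ∑_{j=1}^3 c·y_j(x)·(∂_j u_i(x))·v_i(x)/√(c² + ‖y(x)‖²) is integrable on Ω and |∫_Ω ∑_{i,j} c·y_j(x)·(∂_j u_i(x))·v_i(x)/√(c² + ‖y(x)‖²) dx| ≤ c·(∫_Ω ∑_{i,j} (∂_j u_i(x))² dx)^{1/2}·(∫_Ω ‖v(x)‖² dx)^{1/2}. -/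
open MeasureTheory

lemma pointwise_aux (c : ℝ) (hc : 0 < c) (y v : EuclideanSpace ℝ (Fin 3))
    (D : Fin 3 → Fin 3 → ℝ) :
    |∑ i, ∑ j, c * y j * D i j * v i / Real.sqrt (c ^ 2 + ‖y‖ ^ 2)| ≤
      c * (Real.sqrt (∑ i, ∑ j, D i j ^ 2) * ‖v‖) := by
  set s := Real.sqrt (c ^ 2 + ‖y‖ ^ 2) with hs
  have hspos : 0 < s := Real.sqrt_pos.mpr (by positivity)
  have hys : ‖y‖ ≤ s := Real.le_sqrt_of_sq_le (by nlinarith)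
  have e1 : ∑ i, ∑ j, c * y j * D i j * v i / s
      = c / s * ∑ p : Fin 3 × Fin 3, D p.1 p.2 * (y p.2 * v p.1) := by
    rw [Fintype.sum_prod_type, Finset.mul_sum]
    refine Finset.sum_congr rfl fun i _ => ?_
    rw [Finset.mul_sum]
    refine Finset.sum_congr rfl fun j _ => ?_
    ring
  have e2 : ∑ p : Fin 3 × Fin 3, (y p.2 * v p.1) ^ 2 = (‖y‖ * ‖v‖) ^ 2 := by
    rw [Fintype.sum_prod_type, mul_pow, EuclideanSpace.real_norm_sq_eq,
      EuclideanSpace.real_norm_sq_eq]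
    simp only [Fin.sum_univ_three]
    ring
  have e3 : |∑ p : Fin 3 × Fin 3, D p.1 p.2 * (y p.2 * v p.1)|
      ≤ Real.sqrt (∑ i, ∑ j, D i j ^ 2) * (‖y‖ * ‖v‖) := by
    have h := Finset.sum_mul_sq_le_sq_mul_sq Finset.univ
      (fun p : Fin 3 × Fin 3 => D p.1 p.2) (fun p => y p.2 * v p.1)
    rw [e2, Fintype.sum_prod_type (fun p : Fin 3 × Fin 3 => D p.1 p.2 ^ 2)] at h
    apply abs_le_of_sq_le_sq _ (by positivity)
    rw [mul_pow, Real.sq_sqrt (by positivity)]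
    exact h
  rw [e1, abs_mul, abs_of_pos (div_pos hc hspos)]
  calc c / s * |∑ p : Fin 3 × Fin 3, D p.1 p.2 * (y p.2 * v p.1)|
      ≤ c / s * (Real.sqrt (∑ i, ∑ j, D i j ^ 2) * (s * ‖v‖)) := by
        refine mul_le_mul_of_nonneg_left (e3.trans ?_) (by positivity)
        gcongr
    _ = _ := by field_simp

/-- The trilinear convection form B[y,u,v] of the quasi-relativistic Navier–Stokes
model is well defined and bounded: the integrand is integrable on Ω and
|B[y,u,v]| ≤ c·‖∇u‖_{L²(Ω)}·‖v‖_{L²(Ω)}. -/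
theorem stmt_7 (c : ℝ) (hc : 0 < c) (Ω : Set (EuclideanSpace ℝ (Fin 3)))
    (hΩ : MeasurableSet Ω)
    (y u v : EuclideanSpace ℝ (Fin 3) → EuclideanSpace ℝ (Fin 3))
    (hy : Measurable y) (hu : Differentiable ℝ u)
    (hDu : IntegrableOn
      (fun x => ∑ i, ∑ j, (fderiv ℝ u x (EuclideanSpace.single j 1) i) ^ 2) Ω)
    (hv : Measurable v)
    (hv2 : IntegrableOn (fun x => ‖v x‖ ^ 2) Ω) :
    IntegrableOn (fun x => ∑ i, ∑ j,
        c * y x j * (fderiv ℝ u x (EuclideanSpace.single j 1) i) * v x i /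
          Real.sqrt (c ^ 2 + ‖y x‖ ^ 2)) Ω ∧
    |∫ x in Ω, ∑ i, ∑ j,
        c * y x j * (fderiv ℝ u x (EuclideanSpace.single j 1) i) * v x i /
          Real.sqrt (c ^ 2 + ‖y x‖ ^ 2)| ≤
      c * Real.sqrt (∫ x in Ω, ∑ i, ∑ j,
            (fderiv ℝ u x (EuclideanSpace.single j 1) i) ^ 2) *
        Real.sqrt (∫ x in Ω, ‖v x‖ ^ 2) := by
  have hD : ∀ i j, Measurable fun x => fderiv ℝ u x (EuclideanSpace.single j 1) i := by
    intro i j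
    have := measurable_fderiv_apply_const ℝ u (EuclideanSpace.single j (1:ℝ))
    fun_prop
  set G : EuclideanSpace ℝ (Fin 3) → ℝ := fun x =>
    ∑ i, ∑ j, (fderiv ℝ u x (EuclideanSpace.single j 1) i) ^ 2 with hG
  have hG0 : ∀ x, 0 ≤ G x := fun x => by positivity
  have hGm : Measurable G := by
    refine Finset.measurable_fun_sum _ fun i _ => Finset.measurable_fun_sum _ fun j _ => ?_
    exact (hD i j).pow_const 2
  have hg : MemLp (fun x => Real.sqrt (G x)) 2 (volume.restrict Ω) := by
    rw [memLp_two_iff_integrable_sq hGm.sqrt.aestronglyMeasurable]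
    simp only [Real.sq_sqrt (hG0 _)]
    exact hDu
  have hh : MemLp (fun x => ‖v x‖) 2 (volume.restrict Ω) := by
    rw [memLp_two_iff_integrable_sq hv.norm.aestronglyMeasurable]
    exact hv2
  have hgh : Integrable (fun x => c * (Real.sqrt (G x) * ‖v x‖)) (volume.restrict Ω) :=
    (hg.integrable_mul hh).const_mul c
  have hpt := fun x => pointwise_aux c hc (y x) (v x)
    (fun i j => fderiv ℝ u x (EuclideanSpace.single j 1) i)
  have hfm : Measurable (fun x => ∑ i, ∑ j,
        c * y x j * (fderiv ℝ u x (EuclideanSpace.single j 1) i) * v x i /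
          Real.sqrt (c ^ 2 + ‖y x‖ ^ 2)) := by
    refine Finset.measurable_fun_sum _ fun i _ => Finset.measurable_fun_sum _ fun j _ => ?_
    have h1 := hD i j
    have h2 : Measurable fun x => y x j := by fun_prop
    have h3 : Measurable fun x => v x i := by fun_prop
    exact (((h2.const_mul c).mul h1).mul h3).div ((hy.norm.pow_const 2).const_add _).sqrt
  refine ⟨hgh.mono' hfm.aestronglyMeasurable (Filter.Eventually.of_forall hpt), ?_⟩
  have hold := integral_mul_le_Lp_mul_Lq_of_nonneg (μ := volume.restrict Ω)
    Real.HolderConjugate.two_two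
    (Filter.Eventually.of_forall fun x => Real.sqrt_nonneg (G x))
    (Filter.Eventually.of_forall fun x => norm_nonneg (v x))
    (by simpa using hg) (by simpa using hh)
  simp only [Real.rpow_two, Real.sq_sqrt (hG0 _), ← Real.sqrt_eq_rpow] at hold
  have h1 := norm_integral_le_of_norm_le (f := fun x => ∑ i, ∑ j,
        c * y x j * (fderiv ℝ u x (EuclideanSpace.single j 1) i) * v x i /
          Real.sqrt (c ^ 2 + ‖y x‖ ^ 2)) hgh (Filter.Eventually.of_forall hpt)
  refine h1.trans ?_
  rw [integral_const_mul, mul_assoc]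
  exact mul_le_mul_of_nonneg_left hold hc.le
end
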